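/- arXiv:2501.11816 — 2 statements merged into one kernel-verified Lean document; each statement's English description precedes it below -/
import Mathlib

section
/- Let k, m be positive natural numbers, n = k·m, and let π : Fin n → Fin k be any function whose every fiber has exactly m elements. Let E = {(i,j) : i < j, π(i) ≠ π(j)} ⊆ Fin n × Fin n. For each qubit q ∈ Fin n and module p ∈ Fin k with p ≠ π(q), define two coverage sets: A(q,p) = {(i,j) ∈ E : i = q, π(j) = p} and B(q,p) = {(i,j) ∈ E : j = q, π(i) = p}. Then any finite collection of such coverage sets whose union equals E has cardinality at least k(k-1)m/2. -/
/-- If every fiber of `π : Fin n → Fin k` has `m` elements and `n = k * m`, then exactly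
`k * m * ((k - 1) * m)` ordered pairs are separated by `π`. -/
lemma card_filter_ne_of_card_fiber_eq {k m : ℕ} (π : Fin (k * m) → Fin k)
    (hbal : ∀ p : Fin k, (Finset.univ.filter fun i => π i = p).card = m) :
    (Finset.univ.filter fun e : Fin (k * m) × Fin (k * m) => π e.1 ≠ π e.2).card =
      k * m * ((k - 1) * m) := by
  have hfib (i : Fin (k * m)) :
      (Finset.univ.filter fun j => π i ≠ π j).card = (k - 1) * m := by
    have h := Finset.card_filter_add_card_filter_not (s := Finset.univ) (fun j => π j = π i)
    rw [hbal, Finset.card_univ, Fintype.card_fin] at h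
    simp only [ne_comm (a := π i), ne_eq, Nat.sub_mul, one_mul]
    omega
  rw [Finset.card_filter, Fintype.sum_prod_type]
  simp only [← Finset.card_filter, hfib]
  simp

/-- Separated ordered pairs number at most twice the separated increasing pairs. -/
lemma card_filter_ne_le_two_mul {α β : Type*} [Fintype α] [LinearOrder α] [DecidableEq β]
    (f : α → β) :
    (Finset.univ.filter fun e : α × α => f e.1 ≠ f e.2).card ≤
      2 * (Finset.univ.filter fun e : α × α => e.1 < e.2 ∧ f e.1 ≠ f e.2).card := by
  set E := Finset.univ.filter fun e : α × α => e.1 < e.2 ∧ f e.1 ≠ f e.2 with hE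
  have hsub : (Finset.univ.filter fun e : α × α => f e.1 ≠ f e.2) ⊆ E ∪ E.image Prod.swap := by
    rintro ⟨i, j⟩ h
    have hf : f i ≠ f j := (Finset.mem_filter.mp h).2
    rcases lt_trichotomy i j with hij | rfl | hij
    · exact Finset.mem_union_left _ (by simp [hE, hij, hf])
    · exact absurd rfl hf
    · exact Finset.mem_union_right _
        (Finset.mem_image.mpr ⟨(j, i), by simp [hE, hij, hf.symm], rfl⟩)
  calc _ ≤ (E ∪ E.image Prod.swap).card := Finset.card_le_card hsub
    _ ≤ E.card + (E.image Prod.swap).card := Finset.card_union_le _ _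
    _ ≤ 2 * E.card := by
      have := Finset.card_image_le (s := E) (f := Prod.swap)
      omega


theorem stmt_8 (k m : ℕ) (hk : 0 < k) (hm : 0 < m)
    (π : Fin (k * m) → Fin k)
    (hbal : ∀ p : Fin k, (Finset.univ.filter fun i => π i = p).card = m)
    (E : Finset (Fin (k * m) × Fin (k * m)))
    (hE : E = (Finset.univ.filter fun e : Fin (k * m) × Fin (k * m) =>
      e.1 < e.2 ∧ π e.1 ≠ π e.2))
    (A B : Fin (k * m) → Fin k → Finset (Fin (k * m) × Fin (k * m)))
    (hA : ∀ q p, A q p = E.filter fun e => e.1 = q ∧ π e.2 = p)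
    (hB : ∀ q p, B q p = E.filter fun e => e.2 = q ∧ π e.1 = p)
    (𝒞 : Finset (Finset (Fin (k * m) × Fin (k * m))))
    (h𝒞 : ∀ s ∈ 𝒞, ∃ q p, p ≠ π q ∧ (s = A q p ∨ s = B q p))
    (hcover : 𝒞.sup id = E) :
    k * (k - 1) * m / 2 ≤ 𝒞.card := by
  have hcard : ∀ s ∈ 𝒞, (id s).card ≤ m := by
    intro s hs
    obtain ⟨q, p, -, rfl | rfl⟩ := h𝒞 s hs
    · rw [id, hA]
      refine (Finset.card_le_card_of_injOn Prod.snd (fun e he => ?_)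
        fun e he e' he' h => ?_).trans_eq (hbal p)
      · simp_all
      · simp only [Finset.coe_filter, Set.mem_ofPred_eq] at he he'
        exact Prod.ext (he.2.1.trans he'.2.1.symm) h
    · rw [id, hB]
      refine (Finset.card_le_card_of_injOn Prod.fst (fun e he => ?_)
        fun e he e' he' h => ?_).trans_eq (hbal p)
      · simp_all
      · simp only [Finset.coe_filter, Set.mem_ofPred_eq] at he he'
        exact Prod.ext h (he.2.1.trans he'.2.1.symm)
  have hEle : E.card ≤ 𝒞.card * m := by
    rw [← hcover, Finset.sup_eq_biUnion]
    exact Finset.card_biUnion_le_card_mul _ _ _ hcard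
  have hpairs := card_filter_ne_le_two_mul π
  rw [card_filter_ne_of_card_fiber_eq π hbal, ← hE] at hpairs
  have hmul : k * (k - 1) * m * m ≤ 2 * 𝒞.card * m := by
    calc k * (k - 1) * m * m = k * m * ((k - 1) * m) := by ring
      _ ≤ 2 * E.card := hpairs
      _ ≤ 2 * (𝒞.card * m) := by gcongr
      _ = 2 * 𝒞.card * m := by ring
  have := Nat.le_of_mul_le_mul_right hmul hm
  omega
end

section
/- Let k, m be positive natural numbers, n = k·m, and let π* : Fin n → Fin k be the canonical partition π*(i) = ⌈i/m⌉ (qubits indexed 1,…,n). Let E = {(i,j) : i < j, π*(i) ≠ π*(j)}. Then the family of coverage sets { A(i, κ) : 1 ≤ i ≤ n, π*(i) < κ ≤ k }, where A(i, κ) = {(i,j) ∈ E : π*(j) = κ}, covers all of E, and the number of sets in this family is exactly k(k-1)m/2. -/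
theorem Nat.ceilDiv_lt_succ_iff {m : ℕ} (hm : 0 < m) (i c : ℕ) :
    i ⌈/⌉ m < c + 1 ↔ i ≤ m * c := by
  rw [Nat.lt_succ_iff, ceilDiv_le_iff_le_mul hm]

theorem card_filter_ceilDiv_lt (k m : ℕ) (hm : 0 < m) :
    ((Finset.Icc 1 (k * m) ×ˢ Finset.Icc 1 k).filter fun x : ℕ × ℕ =>
      x.1 ⌈/⌉ m < x.2).card = k * (k - 1) * m / 2 := by
  have fiber : ∀ c ∈ Finset.range k,
      ((Finset.Icc 1 (k * m)).filter fun i => i ⌈/⌉ m < c + 1).card = c * m := by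
    intro c hc
    have hcm : c * m ≤ k * m := Nat.mul_le_mul_right m (Finset.mem_range.mp hc).le
    have : ((Finset.Icc 1 (k * m)).filter fun i => i ⌈/⌉ m < c + 1) =
        Finset.Icc 1 (c * m) := by
      ext i
      simp only [Finset.mem_filter, Finset.mem_Icc, Nat.ceilDiv_lt_succ_iff hm, mul_comm m c]
      omega
    rw [this, Nat.card_Icc, Nat.add_sub_cancel]
  have hIcc : Finset.Icc 1 k = (Finset.range k).image (· + 1) := by
    ext c
    simp only [Finset.mem_Icc, Finset.mem_image, Finset.mem_range]
    exact ⟨fun h => ⟨c - 1, by omega, by omega⟩, by rintro ⟨d, hd, rfl⟩; omega⟩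
  rw [Finset.card_filter, Finset.sum_product_right, hIcc,
    Finset.sum_image (fun _ _ _ _ h => Nat.succ_injective h)]
  simp only [← Finset.card_filter]
  rw [Finset.sum_congr rfl fiber, ← Finset.sum_mul, ← Finset.sum_range_id_mul_two,
    mul_right_comm, Nat.mul_div_cancel _ two_pos]

theorem stmt_9 (k m : ℕ) (hk : 0 < k) (hm : 0 < m)
    (n : ℕ) (hn : n = k * m)
    (πstar : ℕ → ℕ) (hπ : ∀ i, πstar i = i ⌈/⌉ m)
    (E : Finset (ℕ × ℕ))
    (hE : E = (Finset.Icc 1 n ×ˢ Finset.Icc 1 n).filter fun e =>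
      e.1 < e.2 ∧ πstar e.1 ≠ πstar e.2)
    (A : ℕ → ℕ → Finset (ℕ × ℕ))
    (hA : ∀ i κ, A i κ = E.filter fun e => e.1 = i ∧ πstar e.2 = κ)
    (F : Finset (ℕ × ℕ))
    (hF : F = (Finset.Icc 1 n ×ˢ Finset.Icc 1 k).filter fun x =>
      πstar x.1 < x.2) :
    F.biUnion (fun x => A x.1 x.2) = E ∧ F.card = k * (k - 1) * m / 2 := by
  refine ⟨?_, ?_⟩
  · ext e
    simp only [Finset.mem_biUnion, hA, Finset.mem_filter]
    refine ⟨fun ⟨_, _, he, _⟩ => he, fun he => ⟨(e.1, πstar e.2), ?_, he, rfl, rfl⟩⟩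
    rw [hE, Finset.mem_filter, Finset.mem_product, Finset.mem_Icc, Finset.mem_Icc] at he
    obtain ⟨⟨h₁, -, h₂⟩, hlt, hne⟩ := he
    have hmono : πstar e.1 ≤ πstar e.2 := by
      rw [hπ, ceilDiv_le_iff_le_mul hm]
      exact hlt.le.trans ((ceilDiv_le_iff_le_mul hm).mp (hπ e.2).ge)
    have hle : πstar e.2 ≤ k := by
      rw [hπ, ceilDiv_le_iff_le_mul hm, mul_comm, ← hn]
      exact h₂
    simp only [hF, Finset.mem_filter, Finset.mem_product, Finset.mem_Icc]
    exact ⟨⟨h₁, by omega, hle⟩, by omega⟩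
  · simp only [hF, hn, hπ]
    exact card_filter_ceilDiv_lt k m hm
end
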